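/- Let G be a finite simple graph with maximum degree at most Δ, where Δ ≥ 1, let Δ' ≥ 1 be an integer, let ε be a real number with 0 < ε ≤ 1, and let k = ⌈(1+ε)·Δ/Δ'⌉. Consider the random coloring in which each vertex independently and uniformly at random picks a color from {1,…,k} (i.e., the product over the vertices of the uniform measure on {1,…,k}). Then for every vertex v, the probability that strictly more than Δ' neighbors u of v satisfy c(u) = c(v) is at most e^{−ε²·Δ'/6}. -/

import Mathlib

open MeasureTheory

/-- The generating function of the number of vertices of `s` that share the color of `v ∉ s`,
summed over all `k`-colorings. -/
theorem sum_pow_card_filter_eq_color {V : Type*} [Fintype V] [DecidableEq V] {k : ℕ} (hk : 0 < k)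
    (s : Finset V) {v : V} (hv : v ∉ s) (x : ℝ) :
    ∑ c : V → Fin k, x ^ (s.filter fun u => c u = c v).card =
      (k : ℝ) ^ Fintype.card V * (1 + (x - 1) / k) ^ s.card := by
  have hk' : (k : ℝ) ≠ 0 := by positivity
  set f : Fin k → V → Fin k → ℝ := fun a u b =>
    if u = v then (if b = a then 1 else 0) else if u ∈ s then (if b = a then x else 1) else 1
    with hf
  have hsplit (c : V → Fin k) :
      x ^ (s.filter fun u => c u = c v).card = ∑ a, ∏ u, f a u (c u) := by
    rw [Finset.sum_eq_single (c v)]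
    · rw [← Finset.prod_const, Finset.prod_filter, ← Finset.prod_ite_mem_eq]
      refine Finset.prod_congr rfl fun u _ => ?_
      by_cases huv : u = v
      · subst huv; simp [hf, hv]
      · simp [hf, huv]
    · intro a _ ha
      exact Finset.prod_eq_zero (Finset.mem_univ v) (by simp [hf, ha.symm])
    · simp
  have hsum (a : Fin k) (u : V) : ∑ b, f a u b =
      k * ((if u = v then (k : ℝ)⁻¹ else 1) * (if u ∈ s then 1 + (x - 1) / k else 1)) := by
    by_cases huv : u = v
    · subst huv; simp [hf, hv, hk']
    · by_cases hus : u ∈ s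
      · have hb (b : Fin k) : (if b = a then x else 1) = 1 + if b = a then x - 1 else 0 := by
          split_ifs <;> ring
        simp only [hf, huv, hus, if_true, if_false, hb, Finset.sum_add_distrib]
        simp
        field_simp
      · simp [hf, huv, hus]
  simp_rw [hsplit]
  rw [Finset.sum_comm]
  have hprod (a : Fin k) : ∑ c : V → Fin k, ∏ u, f a u (c u) =
      (k : ℝ) ^ Fintype.card V * ((k : ℝ)⁻¹ * (1 + (x - 1) / k) ^ s.card) := by
    rw [← Fintype.prod_sum]
    simp_rw [hsum, Finset.prod_mul_distrib]
    simp [Finset.prod_ite_mem]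
  simp_rw [hprod]
  simp
  field_simp

/-- Probabilities under the uniform random coloring are counted. -/
theorem pi_uniform_apply {V : Type*} [Fintype V] {k : ℕ} (hk : 0 < k) (S : Finset (V → Fin k)) :
    Measure.pi (fun _ : V => ((k : ENNReal))⁻¹ • (Measure.count : Measure (Fin k))) (S : Set _) =
      ENNReal.ofReal (S.card / (k : ℝ) ^ Fintype.card V) := by
  have hfin : IsFiniteMeasure ((k : ENNReal)⁻¹ • (Measure.count : Measure (Fin k))) :=
    Measure.smul_finite _ (by simp [hk.ne'])
  rw [← sum_measure_singleton]
  simp only [Measure.pi_singleton, Measure.smul_apply, Measure.count_singleton, smul_eq_mul,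
    mul_one, Finset.prod_const, Finset.sum_const, nsmul_eq_mul, Finset.card_univ]
  rw [ENNReal.ofReal_div_of_pos (by positivity), ENNReal.ofReal_pow (by positivity),
    ENNReal.ofReal_natCast, ENNReal.ofReal_natCast, div_eq_mul_inv, ENNReal.inv_pow]

/-- The gain in the exponent of the Chernoff bound is at least `ε² / 6` on `[0, 1]`. -/
theorem sq_div_six_le_log_one_add_sub {ε : ℝ} (h0 : 0 ≤ ε) (h1 : ε ≤ 1) :
    ε ^ 2 / 6 ≤ Real.log (1 + ε) - ε / (1 + ε) := by
  have h := Real.le_log_one_add_of_nonneg h0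
  have h2 : ε ^ 2 / 6 ≤ ε ^ 2 / ((ε + 2) * (1 + ε)) := by
    gcongr
    nlinarith
  have h3 : 2 * ε / (ε + 2) - ε / (1 + ε) = ε ^ 2 / ((ε + 2) * (1 + ε)) := by
    field_simp
    ring
  linarith

/-- Let `G` have maximum degree at most `Δ ≥ 1`, `Δ' ≥ 1`, `0 < ε ≤ 1`, and
`k = ⌈(1+ε)·Δ/Δ'⌉`. Under the product over all vertices of the uniform measure on the `k`
colors, for each vertex `v` the probability that strictly more than `Δ'` neighbors `u` of `v`
get `c(u) = c(v)` is at most `e^{-ε²·Δ'/6}`. -/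
theorem stmt_9 {V : Type*} [Fintype V] (G : SimpleGraph V) [DecidableRel G.Adj]
    (Δ Δ' : ℕ) (hΔ : 1 ≤ Δ) (hΔ' : 1 ≤ Δ') (hdeg : G.maxDegree ≤ Δ)
    (ε : ℝ) (hε0 : 0 < ε) (hε1 : ε ≤ 1)
    (k : ℕ) (hk : k = ⌈(1 + ε) * (Δ : ℝ) / (Δ' : ℝ)⌉₊) (v : V) :
    Measure.pi (fun _ : V => ((k : ENNReal))⁻¹ • (Measure.count : Measure (Fin k)))
        {c : V → Fin k | Δ' < ((G.neighborFinset v).filter fun u => c u = c v).card} ≤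
      ENNReal.ofReal (Real.exp (-(ε ^ 2 * (Δ' : ℝ)) / 6)) := by
  classical
  have hΔ0 : (0 : ℝ) < Δ := by exact_mod_cast hΔ
  have hΔ'0 : (0 : ℝ) < Δ' := by exact_mod_cast hΔ'
  have hkle : (1 + ε) * (Δ : ℝ) / Δ' ≤ k := hk ▸ Nat.le_ceil _
  have hkR : (0 : ℝ) < k := lt_of_lt_of_le (by positivity) hkle
  have hk0 : 0 < k := by exact_mod_cast hkR
  set s := G.neighborFinset v with hs
  set S : Finset (V → Fin k) :=
    Finset.univ.filter fun c => Δ' < (s.filter fun u => c u = c v).card with hS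
  have hset : {c : V → Fin k | Δ' < (s.filter fun u => c u = c v).card} = (S : Set _) := by
    simp [hS]
  rw [hset, pi_uniform_apply hk0]
  refine ENNReal.ofReal_le_ofReal ?_
  have hmarkov : (S.card : ℝ) * (1 + ε) ^ Δ' ≤
      (k : ℝ) ^ Fintype.card V * (1 + ε / k) ^ s.card := by
    have hgen := sum_pow_card_filter_eq_color hk0 s (v := v) (by simp [hs]) (1 + ε)
    rw [add_sub_cancel_left] at hgen
    rw [← hgen, ← nsmul_eq_mul]
    calc S.card • (1 + ε) ^ Δ' ≤ ∑ c ∈ S, (1 + ε) ^ (s.filter fun u => c u = c v).card := by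
          refine Finset.card_nsmul_le_sum _ _ _ fun c hc => ?_
          exact pow_le_pow_right₀ (by linarith) (Finset.mem_filter.1 hc).2.le
      _ ≤ _ := Finset.sum_le_sum_of_subset_of_nonneg (Finset.subset_univ _)
          fun _ _ _ => by positivity
  have hexp : (1 + ε / k) ^ s.card ≤ Real.exp (Δ' * (ε / (1 + ε))) := by
    have hcard : (s.card : ℝ) ≤ Δ := by
      exact_mod_cast (G.degree_le_maxDegree v).trans hdeg
    calc (1 + ε / k) ^ s.card ≤ Real.exp (ε / k) ^ s.card := by
          gcongr
          linarith [Real.add_one_le_exp (ε / k)]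
      _ = Real.exp (s.card * (ε / k)) := (Real.exp_nat_mul _ _).symm
      _ ≤ _ := by
          refine Real.exp_le_exp.2 ?_
          calc s.card * (ε / k) ≤ Δ * (ε / ((1 + ε) * (Δ : ℝ) / Δ')) := by gcongr
            _ = _ := by field_simp
  have hpow : (1 + ε) ^ Δ' = Real.exp (Δ' * Real.log (1 + ε)) := by
    rw [Real.exp_nat_mul, Real.exp_log (by linarith)]
  have hlog := sq_div_six_le_log_one_add_sub hε0.le hε1
  have hfinal : Real.exp (Δ' * (ε / (1 + ε))) ≤
      Real.exp (-(ε ^ 2 * (Δ' : ℝ)) / 6) * (1 + ε) ^ Δ' := by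
    rw [hpow, ← Real.exp_add]
    refine Real.exp_le_exp.2 ?_
    nlinarith
  rw [div_le_iff₀ (by positivity)]
  refine le_of_mul_le_mul_right ?_ (show (0 : ℝ) < (1 + ε) ^ Δ' by positivity)
  calc (S.card : ℝ) * (1 + ε) ^ Δ' ≤ (k : ℝ) ^ Fintype.card V * (1 + ε / k) ^ s.card := hmarkov
    _ ≤ (k : ℝ) ^ Fintype.card V * (Real.exp (-(ε ^ 2 * (Δ' : ℝ)) / 6) * (1 + ε) ^ Δ') := by
        gcongr
        exact hexp.trans hfinal
    _ = _ := by ring
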